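/- Let R be an associative ring with unit and let (A, B) be a complete cotorsion pair in Mod R. Then: (b) coresdim_B(Mod R) ≤ pd(A) ≤ id_A(B) + coresdim_B(A) + 1; and (c) resdim_A(Mod R) ≤ id(B) ≤ pd_B(A) + resdim_A(B) + 1. -/

import Mathlib

noncomputable section

open CategoryTheory CategoryTheory.Limits Opposite DirectSum

universe u

namespace CotorsionDim

variable {R : Type u} [Ring R]

/-- `Ext^n_R(M,N) = 0`. -/
def ExtZero (M N : ModuleCat.{u} R) (n : ℕ) : Prop :=
  IsZero (((Ext ℤ (ModuleCat.{u} R) n).obj (op M)).obj N)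

/-- A pair of composable maps forms a short exact sequence `0 → A → B → C → 0`. -/
def IsSES {A B C : ModuleCat.{u} R} (f : A ⟶ B) (g : B ⟶ C) : Prop :=
  ∃ w : f ≫ g = 0, (CategoryTheory.ShortComplex.mk f g w).ShortExact

/-- relative projective dimension `pd_𝒳(M)` -/
def rpd (𝒳 : Set (ModuleCat.{u} R)) (M : ModuleCat.{u} R) : ℕ∞ :=
  sInf {n : ℕ∞ | ∀ j : ℕ, n < (j : ℕ∞) → ∀ X ∈ 𝒳, ExtZero M X j}

/-- relative injective dimension `id_𝒳(M)` -/
def rid (𝒳 : Set (ModuleCat.{u} R)) (M : ModuleCat.{u} R) : ℕ∞ :=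
  sInf {n : ℕ∞ | ∀ j : ℕ, n < (j : ℕ∞) → ∀ X ∈ 𝒳, ExtZero X M j}

/-- `pd_𝒳(𝒴)` -/
def rpdClass (𝒳 𝒴 : Set (ModuleCat.{u} R)) : ℕ∞ := ⨆ Y : 𝒴, rpd 𝒳 Y

/-- `id_𝒳(𝒴)` -/
def ridClass (𝒳 𝒴 : Set (ModuleCat.{u} R)) : ℕ∞ := ⨆ Y : 𝒴, rid 𝒳 Y

/-- projective dimension -/
def pd (M : ModuleCat.{u} R) : ℕ∞ := rpd Set.univ M

/-- injective dimension -/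
def idim (M : ModuleCat.{u} R) : ℕ∞ := rid Set.univ M

/-- `pd(𝒴)` -/
def pdClass (𝒴 : Set (ModuleCat.{u} R)) : ℕ∞ := ⨆ Y : 𝒴, pd Y.1

/-- `id(𝒴)` -/
def idClass (𝒴 : Set (ModuleCat.{u} R)) : ℕ∞ := ⨆ Y : 𝒴, idim Y.1

/-- `M` has an `𝒳`-resolution `0 → X_n → ⋯ → X_0 → M → 0` of length `n`. -/
def HasResLen (𝒳 : Set (ModuleCat.{u} R)) : ℕ → ModuleCat.{u} R → Prop
  | 0, M => M ∈ 𝒳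
  | n+1, M => ∃ (K X : ModuleCat.{u} R) (f : K ⟶ X) (g : X ⟶ M),
      X ∈ 𝒳 ∧ IsSES f g ∧ HasResLen 𝒳 n K

/-- `M` has an `𝒳`-coresolution `0 → M → X_0 → ⋯ → X_n → 0` of length `n`. -/
def HasCoresLen (𝒳 : Set (ModuleCat.{u} R)) : ℕ → ModuleCat.{u} R → Prop
  | 0, M => M ∈ 𝒳
  | n+1, M => ∃ (X C : ModuleCat.{u} R) (f : M ⟶ X) (g : X ⟶ C),
      X ∈ 𝒳 ∧ IsSES f g ∧ HasCoresLen 𝒳 n C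

/-- `resdim_𝒳(M)` -/
def resdim (𝒳 : Set (ModuleCat.{u} R)) (M : ModuleCat.{u} R) : ℕ∞ :=
  ⨅ n : {n : ℕ // HasResLen 𝒳 n M}, (n : ℕ∞)

/-- `coresdim_𝒳(M)` -/
def coresdim (𝒳 : Set (ModuleCat.{u} R)) (M : ModuleCat.{u} R) : ℕ∞ :=
  ⨅ n : {n : ℕ // HasCoresLen 𝒳 n M}, (n : ℕ∞)

/-- `resdim_𝒳(𝒴)` -/
def resdimClass (𝒳 𝒴 : Set (ModuleCat.{u} R)) : ℕ∞ := ⨆ Y : 𝒴, resdim 𝒳 Y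

/-- `coresdim_𝒳(𝒴)` -/
def coresdimClass (𝒳 𝒴 : Set (ModuleCat.{u} R)) : ℕ∞ := ⨆ Y : 𝒴, coresdim 𝒳 Y

/-- `𝒳^∧`, the class of modules with a finite `𝒳`-resolution. -/
def resClosure (𝒳 : Set (ModuleCat.{u} R)) : Set (ModuleCat.{u} R) :=
  {M | ∃ n, HasResLen 𝒳 n M}

/-- `𝒳^∨`, the class of modules with a finite `𝒳`-coresolution. -/
def coresClosure (𝒳 : Set (ModuleCat.{u} R)) : Set (ModuleCat.{u} R) :=
  {M | ∃ n, HasCoresLen 𝒳 n M}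

/-- `(𝒜, ℬ)` is a cotorsion pair. -/
def IsCotorsionPair (𝒜 ℬ : Set (ModuleCat.{u} R)) : Prop :=
  (∀ M, M ∈ 𝒜 ↔ ∀ B ∈ ℬ, ExtZero M B 1) ∧
  (∀ M, M ∈ ℬ ↔ ∀ A ∈ 𝒜, ExtZero A M 1)

/-- completeness of a cotorsion pair -/
def IsComplete (𝒜 ℬ : Set (ModuleCat.{u} R)) : Prop :=
  ∀ M : ModuleCat.{u} R,
    (∃ (B A : ModuleCat.{u} R) (f : B ⟶ A) (g : A ⟶ M), B ∈ ℬ ∧ A ∈ 𝒜 ∧ IsSES f g) ∧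
    (∃ (B A : ModuleCat.{u} R) (f : M ⟶ B) (g : B ⟶ A), B ∈ ℬ ∧ A ∈ 𝒜 ∧ IsSES f g)

/-- heredity of a cotorsion pair -/
def IsHereditary (𝒜 ℬ : Set (ModuleCat.{u} R)) : Prop :=
  ∀ i : ℕ, 1 ≤ i → ∀ A ∈ 𝒜, ∀ B ∈ ℬ, ExtZero A B i

variable (R)

/-- `𝒫`, the class of modules of finite projective dimension. -/
def P : Set (ModuleCat.{u} R) := {M | pd M < ⊤}

variable {R}

/-- `M` admits a projective resolution consisting of finitely generated projectives,
i.e. `M ∈ mod R`. -/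
def InmodR (M : ModuleCat.{u} R) : Prop :=
  ∃ K : ℕ → ModuleCat.{u} R, K 0 = M ∧ ∀ i : ℕ,
    ∃ (Q : ModuleCat.{u} R) (f : K (i+1) ⟶ Q) (g : Q ⟶ K i),
      Module.Finite R Q ∧ Projective Q ∧ IsSES f g

variable (R)

/-- `𝒫^{<∞} = 𝒫 ∩ mod R`. -/
def Pfin : Set (ModuleCat.{u} R) := {M | pd M < ⊤ ∧ InmodR M}

/-- the big finitistic dimension -/
def bigFindim : ℕ∞ := pdClass (P R)

/-- the little finitistic dimension -/
def littleFindim : ℕ∞ := pdClass (Pfin R)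

variable {R}

/-- `𝒳^{⊥₁}` -/
def rperp1 (𝒳 : Set (ModuleCat.{u} R)) : Set (ModuleCat.{u} R) :=
  {M | ∀ X ∈ 𝒳, ExtZero X M 1}

/-- `^{⊥₁}𝒳` -/
def lperp1 (𝒳 : Set (ModuleCat.{u} R)) : Set (ModuleCat.{u} R) :=
  {M | ∀ X ∈ 𝒳, ExtZero M X 1}

/-- `T^⊥ = {M : Ext^i(T,M) = 0 for all i > 0}` -/
def rperpAll (T : ModuleCat.{u} R) : Set (ModuleCat.{u} R) :=
  {M | ∀ i : ℕ, 0 < i → ExtZero T M i}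

/-- `Add T`: direct summands of arbitrary direct sums of copies of `T`. -/
def AddT (T : ModuleCat.{u} R) : Set (ModuleCat.{u} R) :=
  {M | ∃ (I : Type u) (s : M ⟶ ModuleCat.of R (I →₀ T)) (r : ModuleCat.of R (I →₀ T) ⟶ M),
    s ≫ r = 𝟙 M}

/-- `T` is a tilting module. -/
def IsTilting (T : ModuleCat.{u} R) : Prop :=
  pd T < ⊤ ∧
  (∀ i : ℕ, 0 < i → ∀ I : Type u, ExtZero T (ModuleCat.of R (I →₀ T)) i) ∧
  ∃ n, HasCoresLen (AddT T) n (ModuleCat.of R R)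


/-- `𝒳` is closed under arbitrary direct sums (coproducts). -/
def ClosedUnderCoproducts (𝒳 : Set (ModuleCat.{u} R)) : Prop :=
  ∀ (I : Type u) (f : I → ModuleCat.{u} R), (∀ i, f i ∈ 𝒳) →
    ModuleCat.of R (⨁ i, (f i : Type u)) ∈ 𝒳

/-- `𝒳` is closed under direct summands. -/
def ClosedUnderSummands (𝒳 : Set (ModuleCat.{u} R)) : Prop :=
  ∀ (M N : ModuleCat.{u} R) (s : M ⟶ N) (r : N ⟶ M), s ≫ r = 𝟙 M → N ∈ 𝒳 → M ∈ 𝒳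

/-- In positive degrees, vanishing of `Ext` defined by projective resolutions agrees with
vanishing of `Ext` defined by the derived category. -/
theorem extZero_succ_iff (M N : ModuleCat.{u} R) (n : ℕ) :
    ExtZero M N (n + 1) ↔ Subsingleton (Abelian.Ext M N (n + 1)) := by
  let Q := projectiveResolution M
  have hcyc : ExtZero M N (n + 1) ↔ ∀ f : Q.complex.X (n + 1) ⟶ N,
      Q.complex.d (n + 2) (n + 1) ≫ f = 0 →
        ∃ g : Q.complex.X n ⟶ N, Q.complex.d (n + 1) n ≫ g = f := by
    rw [ExtZero, (Q.isoExt (n + 1) N).isZero_iff,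
      ← HomologicalComplex.exactAt_iff_isZero_homology,
      HomologicalComplex.exactAt_iff' _ n (n + 1) (n + 2) (by simp) (by simp),
      ShortComplex.moduleCat_exact_iff]
    rfl
  rw [hcyc]
  constructor
  · intro h
    refine ⟨fun a b ↦ ?_⟩
    have hz : ∀ a : Abelian.Ext M N (n + 1), a = 0 := fun a ↦ by
      obtain ⟨f, hf, rfl⟩ := Q.extMk_surjective a (n + 2) rfl
      exact (Q.extMk_eq_zero_iff f (n + 2) rfl hf n rfl).2 (h f hf)
    rw [hz a, hz b]
  · intro h f hf
    exact (Q.extMk_eq_zero_iff f (n + 2) rfl hf n rfl).1 (Subsingleton.elim _ _)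

theorem extZero_iff {M N : ModuleCat.{u} R} {n : ℕ} (hn : n ≠ 0) :
    ExtZero M N n ↔ Subsingleton (Abelian.Ext M N n) := by
  obtain ⟨n, rfl⟩ := Nat.exists_eq_succ_of_ne_zero hn
  exact extZero_succ_iff M N n

section LongExactSequence

variable {A B C : ModuleCat.{u} R} {f : A ⟶ B} {g : B ⟶ C} {n : ℕ}

theorem IsSES.extZero_left (h : IsSES f g) (X : ModuleCat.{u} R) (hn : n ≠ 0)
    (hC : ExtZero X C n) (hB : ExtZero X B (n + 1)) : ExtZero X A (n + 1) := by
  obtain ⟨w, hS⟩ := h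
  rw [extZero_iff (by lia)] at *
  refine subsingleton_of_forall_eq 0 fun x ↦ ?_
  obtain ⟨y, rfl⟩ := Abelian.Ext.covariant_sequence_exact₁ X hS x (Subsingleton.elim _ _) rfl
  rw [Subsingleton.elim y 0, Abelian.Ext.zero_comp]

theorem IsSES.extZero_right (h : IsSES f g) (X : ModuleCat.{u} R) (hn : n ≠ 0)
    (hB : ExtZero X B n) (hA : ExtZero X A (n + 1)) : ExtZero X C n := by
  obtain ⟨w, hS⟩ := h
  rw [extZero_iff (by lia)] at *
  refine subsingleton_of_forall_eq 0 fun x ↦ ?_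
  obtain ⟨y, rfl⟩ := Abelian.Ext.covariant_sequence_exact₃ X hS x rfl (Subsingleton.elim _ _)
  rw [Subsingleton.elim y 0, Abelian.Ext.zero_comp]

theorem IsSES.extZero_right' (h : IsSES f g) (Y : ModuleCat.{u} R) (hn : n ≠ 0)
    (hA : ExtZero A Y n) (hB : ExtZero B Y (n + 1)) : ExtZero C Y (n + 1) := by
  obtain ⟨w, hS⟩ := h
  rw [extZero_iff (by lia)] at *
  refine subsingleton_of_forall_eq 0 fun x ↦ ?_
  obtain ⟨y, rfl⟩ := Abelian.Ext.contravariant_sequence_exact₃ hS Y x (Subsingleton.elim _ _)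
    (add_comm 1 n)
  rw [Subsingleton.elim y 0, Abelian.Ext.comp_zero]

theorem IsSES.extZero_left' (h : IsSES f g) (Y : ModuleCat.{u} R) (hn : n ≠ 0)
    (hB : ExtZero B Y n) (hC : ExtZero C Y (n + 1)) : ExtZero A Y n := by
  obtain ⟨w, hS⟩ := h
  rw [extZero_iff (by lia)] at *
  refine subsingleton_of_forall_eq 0 fun x ↦ ?_
  obtain ⟨y, rfl⟩ := Abelian.Ext.contravariant_sequence_exact₁ hS Y x (add_comm 1 n)
    (Subsingleton.elim _ _)
  rw [Subsingleton.elim y 0, Abelian.Ext.comp_zero]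

end LongExactSequence

theorem extZero_succ_of_injective (X I : ModuleCat.{u} R) [Injective I] (n : ℕ) :
    ExtZero X I (n + 1) :=
  (extZero_succ_iff X I n).2 (Abelian.Ext.subsingleton_of_injective X I n)

theorem extZero_succ_of_projective (Q Y : ModuleCat.{u} R) [Projective Q] (n : ℕ) :
    ExtZero Q Y (n + 1) :=
  isZero_Ext_succ_of_projective Q Y n

theorem exists_isSES_injective (M : ModuleCat.{u} R) :
    ∃ (I C : ModuleCat.{u} R) (f : M ⟶ I) (g : I ⟶ C), Injective I ∧ IsSES f g :=
  ⟨_, _, Injective.ι M, cokernel.π (Injective.ι M), inferInstance, cokernel.condition _,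
    { exact := ShortComplex.exact_cokernel (Injective.ι M)
      mono_f := inferInstanceAs (Mono (Injective.ι M))
      epi_g := inferInstanceAs (Epi (cokernel.π (Injective.ι M))) }⟩

theorem exists_isSES_projective (M : ModuleCat.{u} R) :
    ∃ (K Q : ModuleCat.{u} R) (f : K ⟶ Q) (g : Q ⟶ M), Projective Q ∧ IsSES f g :=
  ⟨_, _, kernel.ι (Projective.π M), Projective.π M, inferInstance, kernel.condition _,
    { exact := ShortComplex.exact_kernel (Projective.π M)
      mono_f := inferInstanceAs (Mono (kernel.ι (Projective.π M)))
      epi_g := inferInstanceAs (Epi (Projective.π M)) }⟩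

section Cotorsion

variable {𝒜 ℬ : Set (ModuleCat.{u} R)}

theorem IsCotorsionPair.hasCoresLen (h : IsCotorsionPair 𝒜 ℬ) (n : ℕ) (M : ModuleCat.{u} R)
    (hM : ∀ A ∈ 𝒜, ExtZero A M (n + 1)) : HasCoresLen ℬ n M := by
  induction n generalizing M with
  | zero => exact (h.2 M).2 hM
  | succ n ih =>
    obtain ⟨I, C, f, g, _, hfg⟩ := exists_isSES_injective M
    exact ⟨I, C, f, g, (h.2 I).2 fun A _ ↦ extZero_succ_of_injective A I 0, hfg,
      ih C fun A hA ↦ hfg.extZero_right A n.succ_ne_zero (extZero_succ_of_injective A I n)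
        (hM A hA)⟩

theorem IsCotorsionPair.hasResLen (h : IsCotorsionPair 𝒜 ℬ) (n : ℕ) (M : ModuleCat.{u} R)
    (hM : ∀ B ∈ ℬ, ExtZero M B (n + 1)) : HasResLen 𝒜 n M := by
  induction n generalizing M with
  | zero => exact (h.1 M).2 hM
  | succ n ih =>
    obtain ⟨K, Q, f, g, _, hfg⟩ := exists_isSES_projective M
    exact ⟨K, Q, f, g, (h.1 Q).2 fun B _ ↦ extZero_succ_of_projective Q B 0, hfg,
      ih K fun B hB ↦ hfg.extZero_left' B n.succ_ne_zero (extZero_succ_of_projective Q B n)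
        (hM B hB)⟩

end Cotorsion

section Dimension

variable {𝒳 𝒴 : Set (ModuleCat.{u} R)} {X M : ModuleCat.{u} R} {n N : ℕ}

theorem HasCoresLen.extZero (hM : HasCoresLen 𝒳 n M)
    (hX : ∀ j, N < j → ∀ Y ∈ 𝒳, ExtZero X Y j) (j : ℕ) (hj : N + n < j) : ExtZero X M j := by
  induction n generalizing M j with
  | zero => exact hX j hj M hM
  | succ n ih =>
    obtain ⟨Y, C, f, g, hY, hfg, hC⟩ := hM
    obtain ⟨j, rfl⟩ := Nat.exists_eq_succ_of_ne_zero (by lia : j ≠ 0)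
    exact hfg.extZero_left X (by lia) (ih hC j (by lia)) (hX _ (by lia) Y hY)

theorem HasResLen.extZero (hM : HasResLen 𝒳 n M)
    (hX : ∀ j, N < j → ∀ Y ∈ 𝒳, ExtZero Y X j) (j : ℕ) (hj : N + n < j) : ExtZero M X j := by
  induction n generalizing M j with
  | zero => exact hX j hj M hM
  | succ n ih =>
    obtain ⟨K, Y, f, g, hY, hfg, hK⟩ := hM
    obtain ⟨j, rfl⟩ := Nat.exists_eq_succ_of_ne_zero (by lia : j ≠ 0)
    exact hfg.extZero_right' X (by lia) (ih hK j (by lia)) (hX _ (by lia) Y hY)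

theorem rpd_le_iff : rpd 𝒳 M ≤ n ↔ ∀ j : ℕ, n < j → ∀ X ∈ 𝒳, ExtZero M X j := by
  refine ⟨fun h j hj ↦ ?_, fun h ↦ sInf_le fun j hj ↦ h j (by exact_mod_cast hj)⟩
  obtain ⟨a, ha, haj⟩ := sInf_lt_iff.1 (lt_of_le_of_lt h (Nat.cast_lt.2 hj))
  exact ha j haj

theorem rid_le_iff : rid 𝒳 M ≤ n ↔ ∀ j : ℕ, n < j → ∀ X ∈ 𝒳, ExtZero X M j := by
  refine ⟨fun h j hj ↦ ?_, fun h ↦ sInf_le fun j hj ↦ h j (by exact_mod_cast hj)⟩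
  obtain ⟨a, ha, haj⟩ := sInf_lt_iff.1 (lt_of_le_of_lt h (Nat.cast_lt.2 hj))
  exact ha j haj

theorem rpdClass_le_iff :
    rpdClass 𝒳 𝒴 ≤ n ↔ ∀ j : ℕ, n < j → ∀ Y ∈ 𝒴, ∀ X ∈ 𝒳, ExtZero Y X j := by
  simp only [rpdClass, iSup_le_iff, rpd_le_iff, Subtype.forall]
  tauto

theorem ridClass_le_iff :
    ridClass 𝒳 𝒴 ≤ n ↔ ∀ j : ℕ, n < j → ∀ Y ∈ 𝒴, ∀ X ∈ 𝒳, ExtZero X Y j := by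
  simp only [ridClass, iSup_le_iff, rid_le_iff, Subtype.forall]
  tauto

theorem pdClass_eq_rpdClass : pdClass 𝒴 = rpdClass Set.univ 𝒴 := rfl

theorem idClass_eq_ridClass : idClass 𝒴 = ridClass Set.univ 𝒴 := rfl

theorem coresdimClass_le (h : ∀ Y ∈ 𝒴, HasCoresLen 𝒳 n Y) : coresdimClass 𝒳 𝒴 ≤ n :=
  iSup_le fun Y ↦ iInf_le (fun n : {n : ℕ // HasCoresLen 𝒳 n Y.1} ↦ (n : ℕ∞)) ⟨n, h Y Y.2⟩

theorem resdimClass_le (h : ∀ Y ∈ 𝒴, HasResLen 𝒳 n Y) : resdimClass 𝒳 𝒴 ≤ n :=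
  iSup_le fun Y ↦ iInf_le (fun n : {n : ℕ // HasResLen 𝒳 n Y.1} ↦ (n : ℕ∞)) ⟨n, h Y Y.2⟩

theorem exists_hasCoresLen_of_coresdimClass_le (h : coresdimClass 𝒳 𝒴 ≤ n) (hM : M ∈ 𝒴) :
    ∃ m ≤ n, HasCoresLen 𝒳 m M := by
  have hlt : coresdim 𝒳 M < (n + 1 : ℕ) :=
    lt_of_le_of_lt (iSup_le_iff.1 h ⟨M, hM⟩) (Nat.cast_lt.2 n.lt_succ_self)
  obtain ⟨⟨m, hm⟩, hmn⟩ := iInf_lt_iff.1 hlt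
  exact ⟨m, Nat.lt_succ_iff.1 (Nat.cast_lt.1 hmn), hm⟩

theorem exists_hasResLen_of_resdimClass_le (h : resdimClass 𝒳 𝒴 ≤ n) (hM : M ∈ 𝒴) :
    ∃ m ≤ n, HasResLen 𝒳 m M := by
  have hlt : resdim 𝒳 M < (n + 1 : ℕ) :=
    lt_of_le_of_lt (iSup_le_iff.1 h ⟨M, hM⟩) (Nat.cast_lt.2 n.lt_succ_self)
  obtain ⟨⟨m, hm⟩, hmn⟩ := iInf_lt_iff.1 hlt
  exact ⟨m, Nat.lt_succ_iff.1 (Nat.cast_lt.1 hmn), hm⟩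

end Dimension

section Inequalities

variable {𝒜 ℬ : Set (ModuleCat.{u} R)}

theorem IsCotorsionPair.coresdimClass_univ_le (h : IsCotorsionPair 𝒜 ℬ) :
    coresdimClass ℬ Set.univ ≤ pdClass 𝒜 := by
  rcases eq_or_ne (pdClass 𝒜) ⊤ with ht | ht
  · exact ht ▸ le_top
  obtain ⟨n, hn⟩ := ENat.ne_top_iff_exists.1 ht
  have hv := rpdClass_le_iff.1 hn.ge
  exact hn ▸ coresdimClass_le fun M hM ↦ h.hasCoresLen n M fun A hA ↦
    hv (n + 1) n.lt_succ_self A hA M hM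

theorem IsCotorsionPair.resdimClass_univ_le (h : IsCotorsionPair 𝒜 ℬ) :
    resdimClass 𝒜 Set.univ ≤ idClass ℬ := by
  rcases eq_or_ne (idClass ℬ) ⊤ with ht | ht
  · exact ht ▸ le_top
  obtain ⟨n, hn⟩ := ENat.ne_top_iff_exists.1 ht
  have hv := ridClass_le_iff.1 hn.ge
  exact hn ▸ resdimClass_le fun M hM ↦ h.hasResLen n M fun B hB ↦
    hv (n + 1) n.lt_succ_self B hB M hM

theorem IsComplete.pdClass_le (h : IsComplete 𝒜 ℬ) :
    pdClass 𝒜 ≤ ridClass 𝒜 ℬ + coresdimClass ℬ 𝒜 := by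
  rcases eq_or_ne (ridClass 𝒜 ℬ) ⊤ with ht | ht
  · simp [ht]
  rcases eq_or_ne (coresdimClass ℬ 𝒜) ⊤ with ht' | ht'
  · simp [ht']
  obtain ⟨n, hn⟩ := ENat.ne_top_iff_exists.1 ht
  obtain ⟨m, hm⟩ := ENat.ne_top_iff_exists.1 ht'
  have hv := ridClass_le_iff.1 hn.ge
  rw [← hn, ← hm, ← Nat.cast_add, pdClass_eq_rpdClass, rpdClass_le_iff]
  intro j hj A hA M _
  obtain ⟨B, A', f, g, hB, hA', hfg⟩ := (h M).1
  obtain ⟨k, hk, hres⟩ := exists_hasCoresLen_of_coresdimClass_le hm.ge hA'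
  exact hfg.extZero_right A (by lia)
    (hres.extZero (fun i hi Y hY ↦ hv i hi Y hY A hA) j (by lia)) (hv (j + 1) (by lia) B hB A hA)

theorem IsComplete.idClass_le (h : IsComplete 𝒜 ℬ) :
    idClass ℬ ≤ rpdClass ℬ 𝒜 + resdimClass 𝒜 ℬ := by
  rcases eq_or_ne (rpdClass ℬ 𝒜) ⊤ with ht | ht
  · simp [ht]
  rcases eq_or_ne (resdimClass 𝒜 ℬ) ⊤ with ht' | ht'
  · simp [ht']
  obtain ⟨n, hn⟩ := ENat.ne_top_iff_exists.1 ht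
  obtain ⟨m, hm⟩ := ENat.ne_top_iff_exists.1 ht'
  have hv := rpdClass_le_iff.1 hn.ge
  rw [← hn, ← hm, ← Nat.cast_add, idClass_eq_ridClass, ridClass_le_iff]
  intro j hj B hB M _
  obtain ⟨B', A, f, g, hB', hA, hfg⟩ := (h M).2
  obtain ⟨k, hk, hres⟩ := exists_hasResLen_of_resdimClass_le hm.ge hB'
  exact hfg.extZero_left' B (by lia)
    (hres.extZero (fun i hi Y hY ↦ hv i hi Y hY B hB) j (by lia)) (hv (j + 1) (by lia) A hA B hB)

end Inequalities

/-- Theorem 2.2(b),(c): dimension inequalities for a complete cotorsion pair. -/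
theorem stmt13 {R : Type u} [Ring R] (𝒜 ℬ : Set (ModuleCat.{u} R))
    (hcp : IsCotorsionPair 𝒜 ℬ) (hcomp : IsComplete 𝒜 ℬ) :
    (coresdimClass ℬ Set.univ ≤ pdClass 𝒜 ∧
      pdClass 𝒜 ≤ ridClass 𝒜 ℬ + coresdimClass ℬ 𝒜 + 1) ∧
    (resdimClass 𝒜 Set.univ ≤ idClass ℬ ∧
      idClass ℬ ≤ rpdClass ℬ 𝒜 + resdimClass 𝒜 ℬ + 1) := by
  exact ⟨⟨hcp.coresdimClass_univ_le, hcomp.pdClass_le.trans le_self_add⟩,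
    hcp.resdimClass_univ_le, hcomp.idClass_le.trans le_self_add⟩

end CotorsionDim
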